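/- Fix an integer k ≥ 2, let δ ∈ ℕ, let P̄ ∈ 𝒫_δ be an r-quasihomogeneous polynomial of quasidegree δ, and let n ∈ ℕ. Suppose that every coefficient of P̄ on a monomial with ε-exponent strictly less than n vanishes, and that ⟨ε ∂(x^q)/∂x₁ − G_k ∂(x^q)/∂z, ε·P̄⟩_{r,δ+2k−1} = 0 for every monomial x^q ∈ 𝒫_{δ+k} whose ε-exponent q_{k+1} equals n. Then every coefficient of P̄ on a monomial with ε-exponent equal to n vanishes. -/

import Mathlib

open MvPolynomial

noncomputable section

/-- The weight vector `r`: variable `xᵢ` (1-based `i ≤ k`, 0-based index `i-1`) has weight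
`k+1-i`, so on 0-based index `j < k` the weight is `k - j`; `z` is the variable of 0-based
index `k-1` (weight `1`) and `ε` is the variable of 0-based index `k` (weight `2k-1`). -/
def w (k : ℕ) (i : Fin (k + 1)) : ℕ := if (i : ℕ) < k then k - (i : ℕ) else 2 * k - 1

/-- The index of the variable `z = x_k`. -/
def zv (k : ℕ) : Fin (k + 1) := ⟨k - 1, by omega⟩

/-- The index of the variable `ε = x_{k+1}`. -/
def ev (k : ℕ) : Fin (k + 1) := ⟨k, by omega⟩

/-- Membership in `𝒫_δ`: every monomial of `f` has weighted degree `δ`. -/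
def IsQH (k δ : ℕ) (f : MvPolynomial (Fin (k + 1)) ℝ) : Prop :=
  ∀ s ∈ f.support, ∑ i, w k i * s i = δ

/-- `G_k = z^k + Σ_{i=1}^{k-1} x_i z^{i-1}` (0-based: `Σ_{j<k-1} x_j z^j`). -/
def G (k : ℕ) : MvPolynomial (Fin (k + 1)) ℝ :=
  (X (zv k)) ^ k
    + ∑ i : Fin (k + 1), if (i : ℕ) < k - 1 then X i * (X (zv k)) ^ (i : ℕ) else 0

/-- The inner product `⟨f,g⟩_{r,δ} = Σ_{(r,s)=δ} f_s g_s (s!)^r / δ!`. -/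
def ip (k δ : ℕ) (f g : MvPolynomial (Fin (k + 1)) ℝ) : ℝ :=
  ∑ s ∈ f.support ∪ g.support,
    f.coeff s * g.coeff s * ((∏ i, ((s i).factorial : ℝ) ^ w k i) / (δ.factorial : ℝ))

theorem zv_ne_ev {k : ℕ} (hk : 2 ≤ k) : zv k ≠ ev k := by
  simp only [zv, ev, ne_eq, Fin.mk.injEq]
  omega

theorem degreeOf_ev_G {k : ℕ} (hk : 2 ≤ k) : (G k).degreeOf (ev k) = 0 := by
  have hz : (X (zv k) : MvPolynomial (Fin (k + 1)) ℝ).degreeOf (ev k) = 0 :=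
    degreeOf_X_of_ne (zv_ne_ev hk).symm
  have hpow (j : ℕ) : ((X (zv k) : MvPolynomial (Fin (k + 1)) ℝ) ^ j).degreeOf (ev k) = 0 := by
    simpa [hz] using degreeOf_pow_le (ev k) (X (zv k) : MvPolynomial (Fin (k + 1)) ℝ) j
  refine Nat.le_zero.mp ((degreeOf_add_le _ _ _).trans (max_le (hpow k).le ?_))
  refine (degreeOf_sum_le _ _ _).trans (Finset.sup_le fun i _ => ?_)
  split_ifs with hi
  · have hne : ev k ≠ i := by
      rintro rfl
      simp only [ev] at hi
      omega
    exact (degreeOf_mul_le _ _ _).trans (by rw [degreeOf_X_of_ne hne, hpow])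
  · simp

/-- The coefficients of `G_k ∂(x^q)/∂z` vanish on monomials whose `ε`-exponent exceeds that
of `x^q`. -/
theorem coeff_G_mul_pderiv_monomial {k : ℕ} (hk : 2 ≤ k) (q t : Fin (k + 1) →₀ ℕ)
    (ht : q (ev k) < t (ev k)) :
    coeff t (G k * pderiv (zv k) (monomial q (1 : ℝ))) = 0 := by
  rw [pderiv_monomial, coeff_mul_monomial']
  split_ifs with hle
  · rw [notMem_support_iff.mp, zero_mul]
    intro hmem
    have := monomial_le_degreeOf (ev k) hmem
    simp only [degreeOf_ev_G hk, Finsupp.tsub_apply] at this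
    omega
  · rfl

theorem ip_eq_of_forall_ne {k δ : ℕ} {f g : MvPolynomial (Fin (k + 1)) ℝ}
    (t : Fin (k + 1) →₀ ℕ) (ht : ∀ u, u ≠ t → f.coeff u * g.coeff u = 0) :
    ip k δ f g =
      f.coeff t * g.coeff t * ((∏ i, ((t i).factorial : ℝ) ^ w k i) / (δ.factorial : ℝ)) := by
  refine Finset.sum_eq_single t (fun u _ hu => by rw [ht u hu, zero_mul]) fun hnot => ?_
  rw [Finset.mem_union, not_or, notMem_support_iff] at hnot
  rw [hnot.1, zero_mul, zero_mul]

/-- recursion step: if `P̄ ∈ 𝒫_δ` has vanishing coefficients on all monomials of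
`ε`-exponent `< n`, and `⟨ε ∂(x^q)/∂x₁ − G_k ∂(x^q)/∂z, ε·P̄⟩_{r,δ+2k-1} = 0` for every monomial
`x^q ∈ 𝒫_{δ+k}` with `ε`-exponent `q_{k+1} = n`, then every coefficient of `P̄` on a monomial
with `ε`-exponent `n` vanishes. -/
theorem coeffs_eps_n_vanish (k : ℕ) (hk : 2 ≤ k) (δ : ℕ)
    (Pb : MvPolynomial (Fin (k + 1)) ℝ) (hPb : IsQH k δ Pb) (n : ℕ)
    (hlow : ∀ s : Fin (k + 1) →₀ ℕ, s (ev k) < n → Pb.coeff s = 0)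
    (h : ∀ q : Fin (k + 1) →₀ ℕ, (∑ i, w k i * q i = δ + k) → q (ev k) = n →
      ip k (δ + (2 * k - 1))
        (X (ev k) * pderiv 0 (monomial q (1 : ℝ))
          - G k * pderiv (zv k) (monomial q (1 : ℝ)))
        (X (ev k) * Pb) = 0) :
    ∀ s : Fin (k + 1) →₀ ℕ, s (ev k) = n → Pb.coeff s = 0 := by
  intro s hs
  by_contra hne
  have hk0 : (0 : Fin (k + 1)) ≠ ev k := by
    simp only [ev, ne_eq, Fin.ext_iff, Fin.val_zero]
    omega
  have hdeg : ∑ i, w k i * (s + Finsupp.single 0 1 : Fin (k + 1) →₀ ℕ) i = δ + k := by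
    have hw : w k 0 = k := by simp [w, show 0 < k by omega]
    simp only [Finsupp.add_apply, mul_add, Finset.sum_add_distrib, hPb s (mem_support_iff.mpr hne),
      Finsupp.single_apply, mul_ite, mul_one, mul_zero, Finset.sum_ite_eq, Finset.mem_univ,
      if_true, hw]
  have hq : (s + Finsupp.single 0 1 : Fin (k + 1) →₀ ℕ) (ev k) = n := by
    simp [hs, Finsupp.single_eq_of_ne hk0.symm]
  have hfirst : X (ev k) * pderiv 0 (monomial (s + Finsupp.single 0 1) (1 : ℝ)) =
      monomial (Finsupp.single (ev k) 1 + s) ((s 0 : ℝ) + 1) := by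
    rw [pderiv_monomial, add_tsub_cancel_right, X, monomial_mul]
    simp
  have hip := h _ hdeg hq
  rw [ip_eq_of_forall_ne (Finsupp.single (ev k) 1 + s), hfirst, coeff_sub, coeff_monomial,
    if_pos rfl, coeff_G_mul_pderiv_monomial hk _ _ (by simp [hq, hs]), coeff_X_mul, sub_zero]
    at hip
  · have hpos : (0 : ℝ) < (s 0 : ℝ) + 1 := by positivity
    have hfac : (∏ i, (((Finsupp.single (ev k) 1 + s : Fin (k + 1) →₀ ℕ) i).factorial : ℝ) ^ w k i)
        / ((δ + (2 * k - 1)).factorial : ℝ) ≠ 0 := by positivity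
    exact mul_ne_zero (mul_ne_zero hpos.ne' hne) hfac hip
  · intro u hu
    rcases le_or_gt (u (ev k)) n with hun | hun
    · rw [coeff_X_mul']
      split_ifs with hmem
      · rw [hlow, mul_zero]
        have := Finsupp.mem_support_iff.mp hmem
        simp only [Finsupp.tsub_apply, Finsupp.single_eq_same]
        omega
      · rw [mul_zero]
    · rw [hfirst, coeff_sub, coeff_monomial, if_neg hu.symm,
        coeff_G_mul_pderiv_monomial hk _ _ (by rwa [hq]), sub_zero, zero_mul]
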